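/- arXiv:1009.0015 — 2 statements merged into one kernel-verified Lean document; each statement's English description precedes it below -/
import Mathlib

section
/- Let n ≥ 1 and let M be an n × n real matrix with trace ρ := ∑ i, M i i. Then the condition (∀ i j, M j i + (n−1) * M i j − ρ * δ i j = 0) holds if and only if both (∀ i j, M i j + M j i = (2*ρ/n) * δ i j) (vanishing of the symmetric tracefree part, i.e. vanishing shear) and (∀ i j, (n−2) * (M i j − M j i) = 0) (vanishing of the antisymmetric part when n ≠ 2, i.e. vanishing rotation). (With n = d−2 this is the paper's condition ρ_{ji} + (d−3)ρ_{ij} − ρδ_{ij} = 0 ⟺ σ_{ij} = 0 and (d−4)ω_{ij} = 0, the necessary condition for decoupling of Maxwell perturbations.) -/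
/-- Kronecker delta on `Fin n`. -/
def δ {n : ℕ} (i j : Fin n) : ℝ := if i = j then 1 else 0

theorem δ_comm {n : ℕ} (i j : Fin n) : δ i j = δ j i := by
  simp only [δ, eq_comm]

/-- For an `n × n` real matrix `M` with trace `ρ`, the condition
`M j i + (n−1) M i j − ρ δ i j = 0` (for all `i j`) holds iff the symmetric
tracefree part of `M` vanishes (`M i j + M j i = (2ρ/n) δ i j`) and
`(n−2)(M i j − M j i) = 0` (vanishing antisymmetric part when `n ≠ 2`). -/
theorem shear_rotation_condition
    (n : ℕ) (hn : 1 ≤ n) (M : Fin n → Fin n → ℝ) (ρ : ℝ) (hρ : ρ = ∑ i, M i i) :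
    (∀ i j, M j i + ((n : ℝ) - 1) * M i j - ρ * δ i j = 0) ↔
      ((∀ i j, M i j + M j i = (2 * ρ / (n : ℝ)) * δ i j) ∧
       (∀ i j, ((n : ℝ) - 2) * (M i j - M j i) = 0)) := by
  have hn0 : (n : ℝ) ≠ 0 := Nat.cast_ne_zero.mpr (by omega)
  constructor
  · intro h
    refine ⟨fun i j => ?_, fun i j => ?_⟩ <;>
      have hij := h i j <;> have hji := h j i <;> rw [δ_comm j i] at hji
    · field_simp
      linear_combination hij + hji
    · linear_combination hij - hji
  · rintro ⟨hσ, hω⟩ i j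
    have hs : (n : ℝ) * (M i j + M j i) = 2 * ρ * δ i j := by
      rw [hσ i j]
      field_simp
    linear_combination hs / 2 + hω i j / 2
end

section
/- Let n ≥ 1. Let Φ4 : Fin n → Fin n → Fin n → Fin n → ℝ satisfy Φ4 i j k l = −Φ4 j i k l, Φ4 i j k l = −Φ4 i j l k, and Φ4 i j k l = Φ4 k l i j (Riemann-type symmetries), and let Φ2 : Fin n → Fin n → ℝ satisfy the trace relation (1/2)*(Φ2 i k + Φ2 k i) = −(1/2) * ∑ j, Φ4 i j k j for all i, k. Set ΦS i k := (1/2)*(Φ2 i k + Φ2 k i) and φ := ∑ i, Φ2 i i. Define TΦ i k j l := (1/2)*(Φ4 i k j l + Φ4 j k i l) + φ * (1/2)*(δ i k * δ j l + δ j k * δ i l) − ΦS i j * δ k l + (1/2)*((2*Φ2 i l − Φ2 l i) * δ k j + (2*Φ2 j l − Φ2 l j) * δ k i) + (1/2)*((2*Φ2 i k − Φ2 k i) * δ l j + (2*Φ2 j k − Φ2 k j) * δ l i). Then for all indices: (a) TΦ i k j l = TΦ i l j k; (b) ∑ i, TΦ i k i l = 0; (c) ∑ j, TΦ i j k j = −n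 * ΦS i k + φ * δ i k. (With n = d−2 these are the paper's identities T^Φ_{ijil} = 0 and T^Φ_{ijkj} = −(d−2)Φ^S_{ik} + Φδ_{ik}.) -/
theorem δ_self {n : ℕ} (i : Fin n) : δ i i = 1 := by
  simp [δ]

theorem sum_mul_δ {n : ℕ} (f : Fin n → ℝ) (k : Fin n) : ∑ i, f i * δ k i = f k := by
  simp [δ]

/-- For `Φ4` with Riemann-type symmetries and `Φ2` satisfying the
Weyl trace relation `Φ^S_{ik} = −(1/2)Φ4_{ijkj}`, the tensor `TΦ` satisfies
`TΦ i k j l = TΦ i l j k`, `∑ i, TΦ i k i l = 0`, and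
`∑ j, TΦ i j k j = −n Φ^S_{ik} + φ δ_{ik}`. -/
theorem TPhi_identities
    (n : ℕ) (hn : 1 ≤ n)
    (Φ4 : Fin n → Fin n → Fin n → Fin n → ℝ)
    (h1 : ∀ i j k l, Φ4 i j k l = -Φ4 j i k l)
    (h2 : ∀ i j k l, Φ4 i j k l = -Φ4 i j l k)
    (h3 : ∀ i j k l, Φ4 i j k l = Φ4 k l i j)
    (Φ2 : Fin n → Fin n → ℝ)
    (htrace : ∀ i k, (1/2) * (Φ2 i k + Φ2 k i) = -(1/2) * ∑ j, Φ4 i j k j)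
    (ΦS : Fin n → Fin n → ℝ)
    (hΦS : ∀ i k, ΦS i k = (1/2) * (Φ2 i k + Φ2 k i))
    (φ : ℝ) (hφ : φ = ∑ i, Φ2 i i)
    (TΦ : Fin n → Fin n → Fin n → Fin n → ℝ)
    (hTΦ : ∀ i k j l, TΦ i k j l = (1/2) * (Φ4 i k j l + Φ4 j k i l)
      + φ * ((1/2) * (δ i k * δ j l + δ j k * δ i l))
      - ΦS i j * δ k l
      + (1/2) * ((2 * Φ2 i l - Φ2 l i) * δ k j + (2 * Φ2 j l - Φ2 l j) * δ k i)
      + (1/2) * ((2 * Φ2 i k - Φ2 k i) * δ l j + (2 * Φ2 j k - Φ2 k j) * δ l i)) :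
    (∀ i k j l, TΦ i k j l = TΦ i l j k) ∧
    (∀ k l, ∑ i, TΦ i k i l = 0) ∧
    (∀ i k, ∑ j, TΦ i j k j = -(n : ℝ) * ΦS i k + φ * δ i k) := by
  have hS : ∀ i k, ∑ j, Φ4 i j k j = -(Φ2 i k + Φ2 k i) := fun i k => by
    linarith [htrace i k]
  refine ⟨fun i k j l => ?_, fun k l => ?_, fun i k => ?_⟩
  · rw [hTΦ, hTΦ, h3 i k j l, h3 j k i l, δ_comm l k, δ_comm k j, δ_comm k i, δ_comm l j,
      δ_comm l i]
    ring
  · have hsum : ∑ i, Φ4 i k i l = -(Φ2 k l + Φ2 l k) := by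
      rw [← hS]
      exact Finset.sum_congr rfl fun i _ => by rw [h1, h2, neg_neg]
    have hterm : ∀ i, TΦ i k i l = Φ4 i k i l + φ * (δ l i * δ k i) - Φ2 i i * δ k l
        + (2 * Φ2 i l - Φ2 l i) * δ k i + (2 * Φ2 i k - Φ2 k i) * δ l i := fun i => by
      rw [hTΦ, hΦS, δ_comm i k, δ_comm i l]
      ring
    simp only [hterm, Finset.sum_add_distrib, Finset.sum_sub_distrib, ← Finset.mul_sum,
      ← Finset.sum_mul, sum_mul_δ, hsum, ← hφ]
    rw [δ_comm l k]
    ring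
  · have hterm : ∀ j, TΦ i j k j = (1/2) * (Φ4 i j k j + Φ4 k j i j)
        + φ * (δ i j * δ k j) - ΦS i k
        + (2 * Φ2 i j - Φ2 j i) * δ k j + (2 * Φ2 k j - Φ2 j k) * δ i j := fun j => by
      rw [hTΦ, δ_self, δ_comm j k, δ_comm j i]
      ring
    simp only [hterm, Finset.sum_add_distrib, Finset.sum_sub_distrib, ← Finset.mul_sum,
      sum_mul_δ, hS, Finset.sum_const, Finset.card_univ, Fintype.card_fin, nsmul_eq_mul]
    ring
end
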